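/- arXiv:1511.02667 — 5 statements merged into one kernel-verified Lean document; each statement's English description precedes it below -/
import Mathlib

section
/- Theorem 3.3 (implication 2 ⇒ 3): Let F be a symmetric third-order multilinear form on ℝⁿ and let D ⊆ ℝⁿ be any set. If F(x, y−z, y−z) ≥ 0 for all x, y, z ∈ D, then for all x, y, z ∈ D one has F(x,y,z) ≤ max{F(x,x,x), F(y,y,y), F(z,z,z)}. -/
open Finset

/-- The trilinear form associated to a third-order tensor `𝓕` on `ℝⁿ`:
`F(x,y,z) = ∑_{i,j,k} 𝓕_{ijk} x_i y_j z_k`. -/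
def triForm {n : ℕ} (𝓕 : Fin n → Fin n → Fin n → ℝ) (x y z : Fin n → ℝ) : ℝ :=
  ∑ i, ∑ j, ∑ k, 𝓕 i j k * x i * y j * z k

theorem triForm_swap12 {n : ℕ} (𝓕 : Fin n → Fin n → Fin n → ℝ)
    (hsym₁ : ∀ i j k, 𝓕 i j k = 𝓕 j i k) (x y z : Fin n → ℝ) :
    triForm 𝓕 x y z = triForm 𝓕 y x z := by
  unfold triForm
  rw [Finset.sum_comm]
  refine Finset.sum_congr rfl fun i _ => Finset.sum_congr rfl fun j _ =>
    Finset.sum_congr rfl fun k _ => ?_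
  rw [hsym₁ j i k]; ring

theorem triForm_swap23 {n : ℕ} (𝓕 : Fin n → Fin n → Fin n → ℝ)
    (hsym₂ : ∀ i j k, 𝓕 i j k = 𝓕 i k j) (x y z : Fin n → ℝ) :
    triForm 𝓕 x y z = triForm 𝓕 x z y := by
  unfold triForm
  refine Finset.sum_congr rfl fun i _ => ?_
  rw [Finset.sum_comm]
  refine Finset.sum_congr rfl fun j _ => Finset.sum_congr rfl fun k _ => ?_
  rw [hsym₂ i k j]; ring

theorem triForm_sub_right {n : ℕ} (𝓕 : Fin n → Fin n → Fin n → ℝ) (x y z w : Fin n → ℝ) :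
    triForm 𝓕 x y (z - w) = triForm 𝓕 x y z - triForm 𝓕 x y w := by
  simp only [triForm, Pi.sub_apply, mul_sub, Finset.sum_sub_distrib]

theorem triForm_expand {n : ℕ} (𝓕 : Fin n → Fin n → Fin n → ℝ)
    (hsym₂ : ∀ i j k, 𝓕 i j k = 𝓕 i k j) (x y z : Fin n → ℝ) :
    triForm 𝓕 x (y - z) (y - z)
      = triForm 𝓕 x y y - 2 * triForm 𝓕 x y z + triForm 𝓕 x z z := by
  rw [triForm_sub_right, triForm_swap23 𝓕 hsym₂ x (y - z) y,
    triForm_swap23 𝓕 hsym₂ x (y - z) z, triForm_sub_right, triForm_sub_right,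
    triForm_swap23 𝓕 hsym₂ x z y]
  ring

/-- Theorem 3.3, implication 2 ⇒ 3: if `F(x, y−z, y−z) ≥ 0` for all `x, y, z ∈ D`, then
`F(x,y,z) ≤ max {F(x,x,x), F(y,y,y), F(z,z,z)}` for all `x, y, z ∈ D`. -/
theorem thm33_two_implies_three {n : ℕ} (hn : 1 ≤ n)
    (𝓕 : Fin n → Fin n → Fin n → ℝ)
    (hsym₁ : ∀ i j k, 𝓕 i j k = 𝓕 j i k)
    (hsym₂ : ∀ i j k, 𝓕 i j k = 𝓕 i k j)
    (D : Set (Fin n → ℝ))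
    (h : ∀ x ∈ D, ∀ y ∈ D, ∀ z ∈ D, 0 ≤ triForm 𝓕 x (y - z) (y - z)) :
    ∀ x ∈ D, ∀ y ∈ D, ∀ z ∈ D,
      triForm 𝓕 x y z ≤
        max (triForm 𝓕 x x x) (max (triForm 𝓕 y y y) (triForm 𝓕 z z z)) := by
  have key : ∀ x ∈ D, ∀ y ∈ D,
      3 * triForm 𝓕 x y y ≤ triForm 𝓕 x x x + 2 * triForm 𝓕 y y y := by
    intro x hx y hy
    have h1 := h x hx x hx y hy
    have h2 := h y hy x hx y hy
    rw [triForm_expand 𝓕 hsym₂] at h1 h2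
    have e1 : triForm 𝓕 y x y = triForm 𝓕 x y y := triForm_swap12 𝓕 hsym₁ y x y
    have e2 : triForm 𝓕 y x x = triForm 𝓕 x x y := by
      rw [triForm_swap12 𝓕 hsym₁ y x x, triForm_swap23 𝓕 hsym₂ x y x]
    rw [e1, e2] at h2
    linarith
  intro x hx y hy z hz
  have h0 := h x hx y hy z hz
  rw [triForm_expand 𝓕 hsym₂] at h0
  have h1 := key x hx y hy
  have h2 := key x hx z hz
  have m1 := le_max_left (triForm 𝓕 x x x) (max (triForm 𝓕 y y y) (triForm 𝓕 z z z))
  have m2 := le_max_right (triForm 𝓕 x x x) (max (triForm 𝓕 y y y) (triForm 𝓕 z z z))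
  have m3 := le_max_left (triForm 𝓕 y y y) (triForm 𝓕 z z z)
  have m4 := le_max_right (triForm 𝓕 y y y) (triForm 𝓕 z z z)
  linarith
end

section
/- Theorem 3.1 (Nguyen et al.): Let F⁴ be a symmetric fourth-order multilinear form on ℝⁿ whose associated score function S⁴(x) = F⁴(x,x,x,x) is convex on ℝⁿ. Then for any nonempty compact set D ⊆ ℝⁿ, max_{x ∈ D} F⁴(x,x,x,x) = max_{x,y ∈ D} F⁴(x,x,y,y) = max_{x,y,z,t ∈ D} F⁴(x,y,z,t). -/
open Finset

/-- The quadrilinear form associated to a fourth-order tensor `𝓕⁴` on `ℝⁿ`: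
`F⁴(x,y,z,t) = ∑_{i,j,k,l} 𝓕⁴_{ijkl} x_i y_j z_k t_l`. -/
def quadForm {n : ℕ} (𝓕 : Fin n → Fin n → Fin n → Fin n → ℝ)
    (x y z t : Fin n → ℝ) : ℝ :=
  ∑ i, ∑ j, ∑ k, ∑ l, 𝓕 i j k l * x i * y j * z k * t l

section Helpers

variable {n : ℕ} {𝓕 : Fin n → Fin n → Fin n → Fin n → ℝ}

lemma qf_swap1 (hs : ∀ i j k l, 𝓕 i j k l = 𝓕 j i k l) (x y z t : Fin n → ℝ) :
    quadForm 𝓕 x y z t = quadForm 𝓕 y x z t := by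
  unfold quadForm
  rw [Finset.sum_comm]
  refine sum_congr rfl fun i _ => sum_congr rfl fun j _ => sum_congr rfl fun k _ =>
    sum_congr rfl fun l _ => ?_
  rw [hs]; ring

lemma qf_swap2 (hs : ∀ i j k l, 𝓕 i j k l = 𝓕 i k j l) (x y z t : Fin n → ℝ) :
    quadForm 𝓕 x y z t = quadForm 𝓕 x z y t := by
  unfold quadForm
  refine sum_congr rfl fun i _ => ?_
  rw [Finset.sum_comm]
  refine sum_congr rfl fun j _ => sum_congr rfl fun k _ => sum_congr rfl fun l _ => ?_
  rw [hs]; ring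

lemma qf_swap3 (hs : ∀ i j k l, 𝓕 i j k l = 𝓕 i j l k) (x y z t : Fin n → ℝ) :
    quadForm 𝓕 x y z t = quadForm 𝓕 x y t z := by
  unfold quadForm
  refine sum_congr rfl fun i _ => sum_congr rfl fun j _ => ?_
  rw [Finset.sum_comm]
  refine sum_congr rfl fun k _ => sum_congr rfl fun l _ => ?_
  rw [hs]; ring

lemma qf_add1 (x y z t w : Fin n → ℝ) :
    quadForm 𝓕 (x + w) y z t = quadForm 𝓕 x y z t + quadForm 𝓕 w y z t := by
  simp only [quadForm, Pi.add_apply, mul_add, add_mul, sum_add_distrib]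

lemma qf_sub1 (x y z t w : Fin n → ℝ) :
    quadForm 𝓕 (x - w) y z t = quadForm 𝓕 x y z t - quadForm 𝓕 w y z t := by
  simp only [quadForm, Pi.sub_apply, mul_sub, sub_mul, sum_sub_distrib]

lemma qf_smul1 (x y z t : Fin n → ℝ) (c : ℝ) :
    quadForm 𝓕 (c • x) y z t = c * quadForm 𝓕 x y z t := by
  simp only [quadForm, Pi.smul_apply, smul_eq_mul, mul_sum]
  refine sum_congr rfl fun i _ => sum_congr rfl fun j _ => sum_congr rfl fun k _ =>
    sum_congr rfl fun l _ => ?_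
  ring

lemma qf_add2 (x y z t w : Fin n → ℝ) :
    quadForm 𝓕 x (y + w) z t = quadForm 𝓕 x y z t + quadForm 𝓕 x w z t := by
  simp only [quadForm, Pi.add_apply, mul_add, add_mul, sum_add_distrib]

lemma qf_sub2 (x y z t w : Fin n → ℝ) :
    quadForm 𝓕 x (y - w) z t = quadForm 𝓕 x y z t - quadForm 𝓕 x w z t := by
  simp only [quadForm, Pi.sub_apply, mul_sub, sub_mul, sum_sub_distrib]

lemma qf_smul2 (x y z t : Fin n → ℝ) (c : ℝ) :
    quadForm 𝓕 x (c • y) z t = c * quadForm 𝓕 x y z t := by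
  simp only [quadForm, Pi.smul_apply, smul_eq_mul, mul_sum]
  refine sum_congr rfl fun i _ => sum_congr rfl fun j _ => sum_congr rfl fun k _ =>
    sum_congr rfl fun l _ => ?_
  ring

lemma qf_add3 (x y z t w : Fin n → ℝ) :
    quadForm 𝓕 x y (z + w) t = quadForm 𝓕 x y z t + quadForm 𝓕 x y w t := by
  simp only [quadForm, Pi.add_apply, mul_add, add_mul, sum_add_distrib]

lemma qf_sub3 (x y z t w : Fin n → ℝ) :
    quadForm 𝓕 x y (z - w) t = quadForm 𝓕 x y z t - quadForm 𝓕 x y w t := by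
  simp only [quadForm, Pi.sub_apply, mul_sub, sub_mul, sum_sub_distrib]

lemma qf_smul3 (x y z t : Fin n → ℝ) (c : ℝ) :
    quadForm 𝓕 x y (c • z) t = c * quadForm 𝓕 x y z t := by
  simp only [quadForm, Pi.smul_apply, smul_eq_mul, mul_sum]
  refine sum_congr rfl fun i _ => sum_congr rfl fun j _ => sum_congr rfl fun k _ =>
    sum_congr rfl fun l _ => ?_
  ring

lemma qf_add4 (x y z t w : Fin n → ℝ) :
    quadForm 𝓕 x y z (t + w) = quadForm 𝓕 x y z t + quadForm 𝓕 x y z w := by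
  simp only [quadForm, Pi.add_apply, mul_add, add_mul, sum_add_distrib]

lemma qf_sub4 (x y z t w : Fin n → ℝ) :
    quadForm 𝓕 x y z (t - w) = quadForm 𝓕 x y z t - quadForm 𝓕 x y z w := by
  simp only [quadForm, Pi.sub_apply, mul_sub, sub_mul, sum_sub_distrib]

lemma qf_smul4 (x y z t : Fin n → ℝ) (c : ℝ) :
    quadForm 𝓕 x y z (c • t) = c * quadForm 𝓕 x y z t := by
  simp only [quadForm, Pi.smul_apply, smul_eq_mul, mul_sum]
  refine sum_congr rfl fun i _ => sum_congr rfl fun j _ => sum_congr rfl fun k _ =>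
    sum_congr rfl fun l _ => ?_
  ring

lemma qf_nonneg
    (hsym₁ : ∀ i j k l, 𝓕 i j k l = 𝓕 j i k l)
    (hsym₂ : ∀ i j k l, 𝓕 i j k l = 𝓕 i k j l)
    (hsym₃ : ∀ i j k l, 𝓕 i j k l = 𝓕 i j l k)
    (hconv : ConvexOn ℝ Set.univ (fun x : Fin n → ℝ => quadForm 𝓕 x x x x))
    (u v : Fin n → ℝ) : 0 ≤ quadForm 𝓕 u u v v := by
  have key : ∀ w : Fin n → ℝ, 0 ≤ 6 * quadForm 𝓕 w w v v + quadForm 𝓕 w w w w := by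
    intro w
    have h := hconv.2 (Set.mem_univ (v + w)) (Set.mem_univ (v - w))
      (by norm_num : (0:ℝ) ≤ 1/2) (by norm_num : (0:ℝ) ≤ 1/2) (by norm_num)
    have e : (1/2:ℝ) • (v + w) + (1/2:ℝ) • (v - w) = v := by
      ext i; simp; ring
    simp only [e, smul_eq_mul] at h
    have e1 : quadForm 𝓕 (v+w) (v+w) (v+w) (v+w) + quadForm 𝓕 (v-w) (v-w) (v-w) (v-w)
        = 2 * quadForm 𝓕 v v v v + 12 * quadForm 𝓕 w w v v + 2 * quadForm 𝓕 w w w w := by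
      simp only [qf_add1, qf_add2, qf_add3, qf_add4, qf_sub1, qf_sub2, qf_sub3, qf_sub4]
      simp only [qf_swap1 hsym₁ v w, qf_swap2 hsym₂ _ v w, qf_swap3 hsym₃ _ _ v w]
      ring
    linarith
  by_contra hneg
  push Not at hneg
  set a := quadForm 𝓕 u u v v with ha
  set b := quadForm 𝓕 u u u u with hb
  have k2 : ∀ h : ℝ, 0 ≤ h ^ 2 * (6 * a + h ^ 2 * b) := by
    intro h
    have := key (h • u)
    simp only [qf_smul1, qf_smul2, qf_smul3, qf_smul4, ← ha, ← hb] at this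
    nlinarith [this]
  have hb1 : 0 < |b| + 1 := by positivity
  have hp : 0 < (-a) / (|b| + 1) := div_pos (by linarith) hb1
  have h3 := k2 (Real.sqrt ((-a) / (|b| + 1)))
  rw [Real.sq_sqrt hp.le] at h3
  have h4 := nonneg_of_mul_nonneg_right h3 hp
  have h5 : (-a) / (|b| + 1) * b ≤ (-a) / (|b| + 1) * (|b| + 1) :=
    mul_le_mul_of_nonneg_left (by linarith [le_abs_self b]) hp.le
  rw [div_mul_cancel₀ _ hb1.ne'] at h5
  linarith

lemma qf_le
    (hsym₁ : ∀ i j k l, 𝓕 i j k l = 𝓕 j i k l)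
    (hsym₂ : ∀ i j k l, 𝓕 i j k l = 𝓕 i k j l)
    (hsym₃ : ∀ i j k l, 𝓕 i j k l = 𝓕 i j l k)
    (hconv : ConvexOn ℝ Set.univ (fun x : Fin n → ℝ => quadForm 𝓕 x x x x))
    (x y z t : Fin n → ℝ) :
    4 * quadForm 𝓕 x y z t ≤ quadForm 𝓕 x x x x + quadForm 𝓕 y y y y
      + quadForm 𝓕 z z z z + quadForm 𝓕 t t t t := by
  have pos := qf_nonneg hsym₁ hsym₂ hsym₃ hconv
  have two : ∀ x y, 2 * quadForm 𝓕 x x y y ≤ quadForm 𝓕 x x x x + quadForm 𝓕 y y y y := by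
    intro x y
    have h := pos (x + y) (x - y)
    simp only [qf_add1, qf_add2, qf_add3, qf_add4, qf_sub1, qf_sub2, qf_sub3, qf_sub4] at h
    have e1 := qf_swap1 hsym₁
    have e2 := qf_swap2 hsym₂
    have e3 := qf_swap3 hsym₃
    simp only [e1 y x, e2 _ y x, e3 _ _ y x] at h ⊢
    linarith
  have h1 := pos (x + y) (z - t)
  have h2 := pos (x - y) (z + t)
  simp only [qf_add1, qf_add2, qf_add3, qf_add4, qf_sub1, qf_sub2, qf_sub3, qf_sub4] at h1 h2
  have e1 := qf_swap1 hsym₁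
  have e3 := qf_swap3 hsym₃
  simp only [e1 y x, e3 _ _ t z] at h1 h2
  linarith [two x z, two x t, two y z, two y t]

end Helpers

/-- Theorem 3.1 (Nguyen et al.): for a symmetric fourth-order multilinear form `F⁴` whose
score function `S⁴(x) = F⁴(x,x,x,x)` is convex on `ℝⁿ`, and any nonempty compact `D ⊆ ℝⁿ`,
`max_{x ∈ D} F⁴(x,x,x,x) = max_{x,y ∈ D} F⁴(x,x,y,y) = max_{x,y,z,t ∈ D} F⁴(x,y,z,t)`. -/
theorem thm31_nguyen {n : ℕ} (hn : 1 ≤ n)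
    (𝓕 : Fin n → Fin n → Fin n → Fin n → ℝ)
    (hsym₁ : ∀ i j k l, 𝓕 i j k l = 𝓕 j i k l)
    (hsym₂ : ∀ i j k l, 𝓕 i j k l = 𝓕 i k j l)
    (hsym₃ : ∀ i j k l, 𝓕 i j k l = 𝓕 i j l k)
    (hconv : ConvexOn ℝ Set.univ (fun x : Fin n → ℝ => quadForm 𝓕 x x x x))
    (D : Set (Fin n → ℝ)) (hD : IsCompact D) (hDne : D.Nonempty) :
    sSup {r : ℝ | ∃ x ∈ D, quadForm 𝓕 x x x x = r}
        = sSup {r : ℝ | ∃ x ∈ D, ∃ y ∈ D, quadForm 𝓕 x x y y = r}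
      ∧ sSup {r : ℝ | ∃ x ∈ D, ∃ y ∈ D, quadForm 𝓕 x x y y = r}
        = sSup {r : ℝ | ∃ x ∈ D, ∃ y ∈ D, ∃ z ∈ D, ∃ t ∈ D, quadForm 𝓕 x y z t = r} := by
  have hcont : Continuous (fun x : Fin n → ℝ => quadForm 𝓕 x x x x) := by
    unfold quadForm; fun_prop
  obtain ⟨m, hm, hmax⟩ := hD.exists_isMaxOn hDne hcont.continuousOn
  have hmax' : ∀ x ∈ D, quadForm 𝓕 x x x x ≤ quadForm 𝓕 m m m m := fun x hx => hmax hx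
  have hall : ∀ x ∈ D, ∀ y ∈ D, ∀ z ∈ D, ∀ t ∈ D,
      quadForm 𝓕 x y z t ≤ quadForm 𝓕 m m m m := by
    intro x hx y hy z hz t ht
    linarith [qf_le hsym₁ hsym₂ hsym₃ hconv x y z t, hmax' x hx, hmax' y hy, hmax' z hz,
      hmax' t ht]
  have s1 : IsGreatest {r : ℝ | ∃ x ∈ D, quadForm 𝓕 x x x x = r} (quadForm 𝓕 m m m m) :=
    ⟨⟨m, hm, rfl⟩, by rintro _ ⟨x, hx, rfl⟩; exact hmax' x hx⟩
  have s2 : IsGreatest {r : ℝ | ∃ x ∈ D, ∃ y ∈ D, quadForm 𝓕 x x y y = r}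
      (quadForm 𝓕 m m m m) :=
    ⟨⟨m, hm, m, hm, rfl⟩, by rintro _ ⟨x, hx, y, hy, rfl⟩; exact hall x hx x hx y hy y hy⟩
  have s3 : IsGreatest {r : ℝ | ∃ x ∈ D, ∃ y ∈ D, ∃ z ∈ D, ∃ t ∈ D, quadForm 𝓕 x y z t = r}
      (quadForm 𝓕 m m m m) :=
    ⟨⟨m, hm, m, hm, m, hm, m, hm, rfl⟩, by
      rintro _ ⟨x, hx, y, hy, z, hz, t, ht, rfl⟩; exact hall x hx y hy z hz t ht⟩
  rw [s1.csSup_eq, s2.csSup_eq, s3.csSup_eq]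
  exact ⟨rfl, rfl⟩
end

section
/- Lower bound for the modification form (used in the proof of Proposition 3.4): for 0 < ε < 1, every entrywise nonnegative vector x ∈ ℝⁿ (in particular every assignment vector x ∈ M), and every y ∈ ℝⁿ, one has G_ε(x,y,y) ≥ ε(1−ε)²·‖x‖₁·‖y‖₂². -/
open Finset

/-- The perturbed basis vector `e_i^ε = ε·𝟙 + (1−ε)·e_i`. -/
def epsVec {ι : Type*} [DecidableEq ι] (ε : ℝ) (i : ι) : ι → ℝ :=
  fun j => ε + (1 - ε) * (if j = i then 1 else 0)

/-- The modification trilinear form `G_ε(x,y,z) = ∑_i ⟨e_i^ε,x⟩⟨e_i^ε,y⟩⟨e_i^ε,z⟩`. -/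
def Geps {ι : Type*} [Fintype ι] [DecidableEq ι] (ε : ℝ) (x y z : ι → ℝ) : ℝ :=
  ∑ i, (∑ j, epsVec ε i j * x j) * (∑ j, epsVec ε i j * y j) * (∑ j, epsVec ε i j * z j)

/-- Lower bound for the modification form (used in the proof of Proposition 3.4):
for `0 < ε < 1`, every entrywise nonnegative `x` and every `y`,
`G_ε(x,y,y) ≥ ε(1−ε)²·‖x‖₁·‖y‖₂²`. -/
theorem Geps_lower_bound {n : ℕ} (ε : ℝ) (hε0 : 0 < ε) (hε1 : ε < 1)
    (x : Fin n → ℝ) (hx : ∀ i, 0 ≤ x i) (y : Fin n → ℝ) :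
    ε * (1 - ε) ^ 2 * (∑ i, |x i|) * (∑ j, (y j) ^ 2) ≤ Geps ε x y y := by
  have h : ∀ (v : Fin n → ℝ) (i : Fin n),
      ∑ j, epsVec ε i j * v j = ε * (∑ j, v j) + (1 - ε) * v i := by
    intro v i
    simp [epsVec, add_mul, Finset.sum_add_distrib, Finset.mul_sum]
  have habs : ∑ i, |x i| = ∑ i, x i := Finset.sum_congr rfl fun i _ => abs_of_nonneg (hx i)
  have hX : 0 ≤ ∑ i, x i := Finset.sum_nonneg fun i _ => hx i
  unfold Geps
  simp only [h]
  rw [habs]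
  set X := ∑ i, x i
  set Y := ∑ i, y i with hY
  have h1 : ∀ i, ε * X * (ε ^ 2 * Y ^ 2 + 2 * ε * (1 - ε) * Y * y i + (1 - ε) ^ 2 * y i ^ 2) ≤
      (ε * X + (1 - ε) * x i) * (ε * Y + (1 - ε) * y i) * (ε * Y + (1 - ε) * y i) := by
    intro i
    have h2 : 0 ≤ (1 - ε) * x i := mul_nonneg (by linarith) (hx i)
    nlinarith [mul_nonneg h2 (sq_nonneg (ε * Y + (1 - ε) * y i))]
  refine le_trans ?_ (Finset.sum_le_sum fun i _ => h1 i)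
  rw [← Finset.mul_sum, Finset.sum_add_distrib, Finset.sum_add_distrib, ← Finset.mul_sum,
    ← Finset.mul_sum, ← Finset.mul_sum, ← hY, Finset.sum_const, nsmul_eq_mul]
  have h3 : 0 ≤ ((Finset.univ : Finset (Fin n)).card : ℝ) * (ε ^ 2 * Y ^ 2) := by positivity
  have h4 : 0 ≤ 2 * ε * (1 - ε) * Y * Y := by
    have : 0 < 1 - ε := by linarith
    have := mul_nonneg (mul_pos hε0 this).le (mul_self_nonneg Y)
    nlinarith
  have h5 : 0 ≤ ε * X := mul_nonneg hε0.le hX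
  calc ε * (1 - ε) ^ 2 * X * ∑ j, y j ^ 2 = ε * X * ((1 - ε) ^ 2 * ∑ j, y j ^ 2) := by ring
    _ ≤ _ := mul_le_mul_of_nonneg_left (by linarith) h5
end

section
/- Strict monotonicity of the modification form on assignment vectors (inequality established in the proofs of Propositions 3.4 and 3.8): for 0 < ε < 1 and any three assignment vectors x, y, z ∈ M, one has G_ε(x,y,z) ≤ G_ε(x,x,x), and equality holds if and only if x = y = z. In particular, for every non-homogeneous tuple (x,y,z) ∈ M³ (i.e. x ≠ y or y ≠ z or z ≠ x), G_ε(x,x,x) > G_ε(x,y,z). -/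
open Finset

/-- The set of assignment matrices `M`, viewed as binary vectors indexed by
`Fin n₁ × Fin n₂`. -/
def assignSet (n₁ n₂ : ℕ) : Set (Fin n₁ × Fin n₂ → ℝ) :=
  {x | (∀ p, x p = 0 ∨ x p = 1) ∧ (∀ i, ∑ j, x (i, j) = 1) ∧ (∀ j, ∑ i, x (i, j) ≤ 1)}

theorem epsVec_inner {ι : Type*} [Fintype ι] [DecidableEq ι] (ε : ℝ) (i : ι) (x : ι → ℝ) :
    ∑ j, epsVec ε i j * x j = ε * ∑ j, x j + (1 - ε) * x i := by
  simp only [epsVec, add_mul, Finset.sum_add_distrib, Finset.mul_sum]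
  simp [mul_assoc, ← Finset.mul_sum]

theorem assign_sum {n₁ n₂ : ℕ} {x : Fin n₁ × Fin n₂ → ℝ} (hx : x ∈ assignSet n₁ n₂) :
    ∑ p, x p = n₁ := by
  rw [Fintype.sum_prod_type]
  simp [hx.2.1]

theorem pointwise_bound {a b x y z : ℝ} (hb : 0 ≤ b)
    (hx : x = 0 ∨ x = 1) (hy : y = 0 ∨ y = 1) (hz : z = 0 ∨ z = 1) :
    a * b ^ 2 / 2 * ((x - y) ^ 2 + (y - z) ^ 2 + (x - z) ^ 2)
      + (a ^ 2 * b + a * b ^ 2 + b ^ 3 / 3) * (2 * x - y - z)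
      + (a + b * x) * (a + b * y) * (a + b * z)
      ≤ (a + b * x) * (a + b * x) * (a + b * x) := by
  have h3 : 0 ≤ b ^ 3 := by positivity
  rcases hx with rfl | rfl <;> rcases hy with rfl | rfl <;> rcases hz with rfl | rfl <;>
    nlinarith

theorem Geps_gap {n₁ n₂ : ℕ} (ε : ℝ) (hε1 : ε < 1)
    (x y z : Fin n₁ × Fin n₂ → ℝ)
    (hx : x ∈ assignSet n₁ n₂) (hy : y ∈ assignSet n₁ n₂) (hz : z ∈ assignSet n₁ n₂) :
    (ε * n₁) * (1 - ε) ^ 2 / 2 * ∑ p, ((x p - y p) ^ 2 + (y p - z p) ^ 2 + (x p - z p) ^ 2)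
      + Geps ε x y z ≤ Geps ε x x x := by
  have hb : 0 ≤ 1 - ε := by linarith
  have h := Finset.sum_le_sum (fun p (_ : p ∈ (Finset.univ : Finset (Fin n₁ × Fin n₂))) =>
    pointwise_bound (a := ε * n₁) hb (hx.1 p) (hy.1 p) (hz.1 p))
  simp only [Finset.sum_add_distrib (s := Finset.univ) (f := fun p => _ + _ * (2 * x p - y p - z p)),
    Finset.sum_add_distrib (g := fun p => _ * (2 * x p - y p - z p)),
    ← Finset.mul_sum, Finset.sum_sub_distrib, assign_sum hx, assign_sum hy, assign_sum hz] at h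
  simp only [Geps, epsVec_inner, assign_sum hx, assign_sum hy, assign_sum hz]
  linarith

/-- Strict monotonicity of the modification form on assignment vectors: for `0 < ε < 1`
and `x, y, z ∈ M`, `G_ε(x,y,z) ≤ G_ε(x,x,x)` with equality iff `x = y = z`; in particular
`G_ε(x,x,x) > G_ε(x,y,z)` for every non-homogeneous tuple. -/
theorem Geps_strict_monotonicity {n₁ n₂ : ℕ} (h₁ : 1 ≤ n₁) (h₁₂ : n₁ ≤ n₂)
    (ε : ℝ) (hε0 : 0 < ε) (hε1 : ε < 1)
    (x y z : Fin n₁ × Fin n₂ → ℝ)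
    (hx : x ∈ assignSet n₁ n₂) (hy : y ∈ assignSet n₁ n₂) (hz : z ∈ assignSet n₁ n₂) :
    Geps ε x y z ≤ Geps ε x x x ∧
      (Geps ε x y z = Geps ε x x x ↔ x = y ∧ y = z) ∧
      ((x ≠ y ∨ y ≠ z ∨ z ≠ x) → Geps ε x y z < Geps ε x x x) := by
  have hgap := Geps_gap ε hε1 x y z hx hy hz
  have hn : (0 : ℝ) < n₁ := by exact_mod_cast h₁
  have hb : 0 < 1 - ε := by linarith
  have hc : 0 < (ε * n₁) * (1 - ε) ^ 2 / 2 := by positivity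
  have hnn : ∀ p ∈ (Finset.univ : Finset (Fin n₁ × Fin n₂)),
      0 ≤ (x p - y p) ^ 2 + (y p - z p) ^ 2 + (x p - z p) ^ 2 := fun p _ => by positivity
  have hs := Finset.sum_nonneg hnn
  have hle : Geps ε x y z ≤ Geps ε x x x := by nlinarith [mul_nonneg hc.le hs]
  have heq : Geps ε x y z = Geps ε x x x → x = y ∧ y = z := by
    intro he
    have h0 : ∑ p, ((x p - y p) ^ 2 + (y p - z p) ^ 2 + (x p - z p) ^ 2) = 0 := by
      refine le_antisymm ?_ hs
      by_contra! hlt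
      have := mul_pos hc hlt
      linarith
    rw [Finset.sum_eq_zero_iff_of_nonneg hnn] at h0
    constructor <;> funext p <;> have hp := h0 p (Finset.mem_univ p)
    · nlinarith [sq_nonneg (x p - y p), sq_nonneg (y p - z p), sq_nonneg (x p - z p),
        pow_eq_zero_iff (two_ne_zero) |>.1 (show (x p - y p) ^ 2 = 0 by
          nlinarith [sq_nonneg (x p - y p), sq_nonneg (y p - z p), sq_nonneg (x p - z p)])]
    · nlinarith [sq_nonneg (x p - y p), sq_nonneg (y p - z p), sq_nonneg (x p - z p),
        pow_eq_zero_iff (two_ne_zero) |>.1 (show (y p - z p) ^ 2 = 0 by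
          nlinarith [sq_nonneg (x p - y p), sq_nonneg (y p - z p), sq_nonneg (x p - z p)])]
  refine ⟨hle, ⟨heq, ?_⟩, ?_⟩
  · rintro ⟨rfl, rfl⟩
    rfl
  · intro hne
    refine lt_of_le_of_ne hle fun he => ?_
    obtain ⟨rfl, rfl⟩ := heq he
    simp at hne
end

section
/- Intermediate inequality in the proof of Theorem 3.3 (2 ⇒ 3): let F be a symmetric third-order multilinear form on ℝⁿ and x, y, z ∈ ℝⁿ. If F(u, v−w, v−w) ≥ 0 for all u, v, w ∈ {x, y, z}, then F(x,x,y) + F(x,y,y) + F(x,x,z) + F(x,z,z) + F(y,y,z) + F(y,z,z) ≤ 2F(x,x,x) + 2F(y,y,y) + 2F(z,z,z). -/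
open Finset

theorem triForm_swap₁₂ {n : ℕ} (𝓕 : Fin n → Fin n → Fin n → ℝ)
    (hsym₁ : ∀ i j k, 𝓕 i j k = 𝓕 j i k) (a b c : Fin n → ℝ) :
    triForm 𝓕 a b c = triForm 𝓕 b a c := by
  unfold triForm
  rw [Finset.sum_comm]
  refine Finset.sum_congr rfl fun i _ => Finset.sum_congr rfl fun j _ =>
    Finset.sum_congr rfl fun k _ => ?_
  rw [hsym₁ j i k]; ring

theorem triForm_swap₂₃ {n : ℕ} (𝓕 : Fin n → Fin n → Fin n → ℝ)
    (hsym₂ : ∀ i j k, 𝓕 i j k = 𝓕 i k j) (a b c : Fin n → ℝ) :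
    triForm 𝓕 a b c = triForm 𝓕 a c b := by
  unfold triForm
  refine Finset.sum_congr rfl fun i _ => ?_
  rw [Finset.sum_comm]
  refine Finset.sum_congr rfl fun j _ => Finset.sum_congr rfl fun k _ => ?_
  rw [hsym₂ i k j]; ring

theorem triForm_expand_s15 {n : ℕ} (𝓕 : Fin n → Fin n → Fin n → ℝ) (u v w : Fin n → ℝ) :
    triForm 𝓕 u (v - w) (v - w) =
      triForm 𝓕 u v v - triForm 𝓕 u v w - triForm 𝓕 u w v + triForm 𝓕 u w w := by
  unfold triForm
  simp only [← Finset.sum_sub_distrib, ← Finset.sum_add_distrib]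
  refine Finset.sum_congr rfl fun i _ => Finset.sum_congr rfl fun j _ =>
    Finset.sum_congr rfl fun k _ => ?_
  simp only [Pi.sub_apply]; ring

theorem triForm_pair {n : ℕ} (𝓕 : Fin n → Fin n → Fin n → ℝ)
    (hsym₁ : ∀ i j k, 𝓕 i j k = 𝓕 j i k)
    (hsym₂ : ∀ i j k, 𝓕 i j k = 𝓕 i k j) (a b : Fin n → ℝ)
    (ha : 0 ≤ triForm 𝓕 a (a - b) (a - b)) (hb : 0 ≤ triForm 𝓕 b (a - b) (a - b)) :
    triForm 𝓕 a a b + triForm 𝓕 a b b ≤ triForm 𝓕 a a a + triForm 𝓕 b b b := by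
  rw [triForm_expand_s15] at ha hb
  have e1 := triForm_swap₂₃ 𝓕 hsym₂ a b a
  have e2 := triForm_swap₁₂ 𝓕 hsym₁ b a a
  have e3 := triForm_swap₁₂ 𝓕 hsym₁ b a b
  have e4 := triForm_swap₂₃ 𝓕 hsym₂ b b a
  linarith

/-- Intermediate inequality in the proof of Theorem 3.3 (2 ⇒ 3): if
`F(u, v−w, v−w) ≥ 0` for all `u, v, w ∈ {x, y, z}`, then
`F(x,x,y)+F(x,y,y)+F(x,x,z)+F(x,z,z)+F(y,y,z)+F(y,z,z) ≤ 2F(x,x,x)+2F(y,y,y)+2F(z,z,z)`. -/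
theorem thm33_intermediate_one {n : ℕ} (hn : 1 ≤ n)
    (𝓕 : Fin n → Fin n → Fin n → ℝ)
    (hsym₁ : ∀ i j k, 𝓕 i j k = 𝓕 j i k)
    (hsym₂ : ∀ i j k, 𝓕 i j k = 𝓕 i k j)
    (x y z : Fin n → ℝ)
    (h : ∀ u ∈ ({x, y, z} : Set (Fin n → ℝ)), ∀ v ∈ ({x, y, z} : Set (Fin n → ℝ)),
      ∀ w ∈ ({x, y, z} : Set (Fin n → ℝ)), 0 ≤ triForm 𝓕 u (v - w) (v - w)) :
    triForm 𝓕 x x y + triForm 𝓕 x y y + triForm 𝓕 x x z + triForm 𝓕 x z z +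
        triForm 𝓕 y y z + triForm 𝓕 y z z
      ≤ 2 * triForm 𝓕 x x x + 2 * triForm 𝓕 y y y + 2 * triForm 𝓕 z z z := by
  have h1 := triForm_pair 𝓕 hsym₁ hsym₂ x y (h x (by simp) x (by simp) y (by simp))
    (h y (by simp) x (by simp) y (by simp))
  have h2 := triForm_pair 𝓕 hsym₁ hsym₂ x z (h x (by simp) x (by simp) z (by simp))
    (h z (by simp) x (by simp) z (by simp))
  have h3 := triForm_pair 𝓕 hsym₁ hsym₂ y z (h y (by simp) y (by simp) z (by simp))
    (h z (by simp) y (by simp) z (by simp))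
  linarith
end
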